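/- arXiv:2002.06236 — 3 statements merged into one kernel-verified Lean document; each statement's English description precedes it below -/
import Mathlib

section
/- Let ψ : ℝ → ℝ be a smooth function with ψ(θ) = 0 for |θ| ≤ 1, 0 ≤ ψ(θ) ≤ 1 for 1 ≤ |θ| ≤ 2, and ψ(θ) = 1 for |θ| ≥ 2. For ε ∈ (0,1] and k ∈ ℤ set z_ε(k) = (1/(2π)) ∫_{−π}^{π} e^{ikθ}(1 − ψ(θ/ε)) dθ and Δ_{ε,0}(k) = |z_ε(k) − z_ε(k−1)|, and inductively define Δ_{ε,p+1}(k) = Σ_{j=−∞}^{k} Δ_{ε,p}(j) for k < 0 and Δ_{ε,p+1}(k) = −Σ_{j=k+1}^{∞} Δ_{ε,p}(j) for k ≥ 0. Then for each integer j ≥ 0 there exists a constant C_j > 0 (depending only on ψ and j) such that Σ_{k∈ℤ} |Δ_{ε,j}(k)| ≤ C_j ε^{1−j} for all ε ∈ (0,1]. -/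
open Filter Topology

/-- `z_ε(k) = (1/2π) ∫_{-π}^{π} e^{ikθ} (1 - ψ(θ/ε)) dθ`. -/
noncomputable def zSeq (ψ : ℝ → ℝ) (ε : ℝ) (k : ℤ) : ℂ :=
  (1 / (2 * Real.pi)) *
    ∫ θ in (-Real.pi)..Real.pi, Complex.exp (Complex.I * k * θ) * (1 - (ψ (θ / ε) : ℂ))

/-- The iterated differences `Δ_{ε,p}`: `Δ_{ε,0}(k) = |z_ε(k) - z_ε(k-1)|`,
`Δ_{ε,p+1}(k) = Σ_{j≤k} Δ_{ε,p}(j)` for `k < 0` and `= -Σ_{j≥k+1} Δ_{ε,p}(j)` for `k ≥ 0`. -/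
noncomputable def deltaIter (ψ : ℝ → ℝ) (ε : ℝ) : ℕ → ℤ → ℝ
  | 0, k => ‖zSeq ψ ε k - zSeq ψ ε (k - 1)‖
  | p + 1, k =>
      if k < 0 then ∑' j : {j : ℤ // j ≤ k}, deltaIter ψ ε p j
      else -∑' j : {j : ℤ // k + 1 ≤ j}, deltaIter ψ ε p j

open scoped SchwartzMap FourierTransform ContDiff

section Weights

variable {ε : ℝ}

lemma sum_range_inv_sq_le (hε : 0 < ε) (hε1 : ε ≤ 1) (n : ℕ) :
    ∑ i ∈ Finset.range n, ((1 + ε * i) ^ 2)⁻¹ ≤ 2 / ε * (1 - (1 + ε * n)⁻¹) := by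
  induction n with
  | zero => simp
  | succ n ih =>
    rw [Finset.sum_range_succ]
    have hn : 0 ≤ ε * (n : ℝ) := by positivity
    suffices h : ((1 + ε * n) ^ 2)⁻¹ ≤
        2 / ε * ((1 + ε * (n : ℝ))⁻¹ - (1 + ε * ((n + 1 : ℕ) : ℝ))⁻¹) by linarith
    have h1 : 0 < 1 + ε * (n : ℝ) := by positivity
    have h2 : 0 < 1 + ε * ((n : ℝ) + 1) := by positivity
    have heq : 2 / ε * ((1 + ε * (n : ℝ))⁻¹ - (1 + ε * ((n : ℝ) + 1))⁻¹) =
        2 / ((1 + ε * n) * (1 + ε * ((n : ℝ) + 1))) := by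
      field_simp
      ring
    push_cast
    rw [heq, inv_eq_one_div, div_le_div_iff₀ (by positivity) (by positivity)]
    nlinarith

lemma summable_and_tsum_inv_sq_le (hε : 0 < ε) (hε1 : ε ≤ 1) :
    Summable (fun k : ℤ => ((1 + ε * |(k : ℝ)|) ^ 2)⁻¹) ∧
      ∑' k : ℤ, ((1 + ε * |(k : ℝ)|) ^ 2)⁻¹ ≤ 4 / ε := by
  have hbound (n : ℕ) : ∑ i ∈ Finset.range n, ((1 + ε * i) ^ 2)⁻¹ ≤ 2 / ε := by
    refine (sum_range_inv_sq_le hε hε1 n).trans (mul_le_of_le_one_right (by positivity) ?_)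
    have : 0 ≤ (1 + ε * (n : ℝ))⁻¹ := by positivity
    linarith
  have hnonneg (n : ℕ) : 0 ≤ ((1 + ε * (n : ℝ)) ^ 2)⁻¹ := by positivity
  have hs := summable_of_sum_range_le hnonneg hbound
  have ht := Real.tsum_le_of_sum_range_le hnonneg hbound
  set w : ℤ → ℝ := fun k => ((1 + ε * |(k : ℝ)|) ^ 2)⁻¹ with hw
  have hpos : (fun n : ℕ => w n) = fun n : ℕ => ((1 + ε * (n : ℝ)) ^ 2)⁻¹ := by
    funext n
    simp [hw]
  have hneg (n : ℕ) : w (-((n : ℤ) + 1)) ≤ ((1 + ε * (n : ℝ)) ^ 2)⁻¹ := by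
    have habs : |((-((n : ℤ) + 1) : ℤ) : ℝ)| = (n : ℝ) + 1 := by
      push_cast
      rw [← abs_neg, neg_neg, abs_of_nonneg (by positivity)]
    simp only [hw]
    rw [habs]
    gcongr
    linarith
  have hw0 (k : ℤ) : 0 ≤ w k := by
    simp only [hw]
    positivity
  have hsneg : Summable (fun n : ℕ => w (-((n : ℤ) + 1))) :=
    Summable.of_nonneg_of_le (fun n => hw0 _) hneg hs
  have htneg := hsneg.tsum_le_tsum hneg hs
  have hspos : Summable (fun n : ℕ => w n) := hpos ▸ hs
  refine ⟨Summable.of_nat_of_neg_add_one hspos hsneg, ?_⟩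
  rw [tsum_of_nat_of_neg_add_one hspos hsneg, hpos]
  calc _ ≤ 2 / ε + 2 / ε := add_le_add ht (htneg.trans ht)
    _ = 4 / ε := by ring

/-- A sequence of size `A (1 + ε|k|)^{-N-2}` has tail sums of size `(4A/ε) (1 + ε|k|)^{-N}` over
sets of indices of absolute value at least `|k|`. -/
lemma abs_tsum_subtype_le (hε : 0 < ε) (hε1 : ε ≤ 1) {f : ℤ → ℝ} {A : ℝ} (hA : 0 ≤ A) {N : ℕ}
    (hf : ∀ k : ℤ, |f k| ≤ A * ((1 + ε * |(k : ℝ)|) ^ (N + 2))⁻¹) {p : ℤ → Prop} {k : ℤ}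
    (hp : ∀ j, p j → |(k : ℝ)| ≤ |(j : ℝ)|) :
    |∑' j : {j : ℤ // p j}, f j| ≤ 4 * A / ε * ((1 + ε * |(k : ℝ)|) ^ N)⁻¹ := by
  obtain ⟨hs, ht⟩ := summable_and_tsum_inv_sq_le hε hε1
  set w : ℤ → ℝ := fun k => ((1 + ε * |(k : ℝ)|) ^ 2)⁻¹
  have hw (k : ℤ) : 0 ≤ w k := by positivity
  set B := A * ((1 + ε * |(k : ℝ)|) ^ N)⁻¹
  have hB : 0 ≤ B := by positivity
  have hle (j : {j : ℤ // p j}) : ‖f j‖ ≤ B * w j := by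
    rw [Real.norm_eq_abs]
    refine (hf j).trans ?_
    rw [pow_add, mul_inv, ← mul_assoc]
    have := hp j j.2
    simp only [B, w]
    gcongr
  have hsub : Summable (fun j : {j : ℤ // p j} => B * w j) :=
    (hs.comp_injective Subtype.val_injective).mul_left B
  have hsum : ∑' j : {j : ℤ // p j}, w j ≤ ∑' j, w j :=
    hs.tsum_subtype_le w {j | p j} hw
  calc |∑' j : {j : ℤ // p j}, f j| ≤ ∑' j : {j : ℤ // p j}, B * w j :=
        tsum_of_norm_bounded hsub.hasSum hle
    _ = B * ∑' j : {j : ℤ // p j}, w j := tsum_mul_left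
    _ ≤ B * (4 / ε) := by gcongr; exact hsum.trans ht
    _ = _ := by simp only [B]; ring

end Weights

/-- The increments of a Schwartz function over a step of size `a` are `O(a)` and decay rapidly. -/
lemma SchwartzMap.exists_norm_sub_le (G : 𝓢(ℝ, ℂ)) (N : ℕ) :
    ∃ C, 0 ≤ C ∧ ∀ a : ℝ, 0 ≤ a → a ≤ 1 → ∀ x : ℝ,
      ‖G x - G (x + a)‖ ≤ C * a * ((1 + |x|) ^ N)⁻¹ := by
  set S := 2 ^ N * (Finset.Iic (N, 0)).sup (fun m => SchwartzMap.seminorm ℝ m.1 m.2)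
    (SchwartzMap.derivCLM ℝ ℂ G)
  have hdecay (y : ℝ) : (1 + |y|) ^ N * ‖deriv G y‖ ≤ S := by
    simpa using SchwartzMap.one_add_le_sup_seminorm_apply (𝕜 := ℝ) (m := (N, 0)) le_rfl le_rfl
      (SchwartzMap.derivCLM ℝ ℂ G) y
  have hS : 0 ≤ S := le_trans (by positivity) (hdecay 0)
  refine ⟨2 ^ N * S, by positivity, fun a ha ha1 x => ?_⟩
  have hderiv (y : ℝ) (hy : y ∈ Set.Icc x (x + a)) :
      ‖deriv G y‖ ≤ 2 ^ N * S * ((1 + |x|) ^ N)⁻¹ := by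
    have hxy : 1 + |x| ≤ 2 * (1 + |y|) := by
      have h1 : |x| ≤ |y| + |x - y| := by simpa using abs_add_le y (x - y)
      have h2 : |x - y| ≤ 1 := abs_le.2 ⟨by linarith [hy.2], by linarith [hy.1]⟩
      linarith [abs_nonneg y]
    rw [← div_eq_mul_inv, le_div_iff₀ (by positivity)]
    calc ‖deriv G y‖ * (1 + |x|) ^ N ≤ ‖deriv G y‖ * (2 * (1 + |y|)) ^ N := by gcongr
      _ = 2 ^ N * ((1 + |y|) ^ N * ‖deriv G y‖) := by rw [mul_pow]; ring
      _ ≤ 2 ^ N * S := by gcongr; exact hdecay y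
  have := (convex_Icc x (x + a)).norm_image_sub_le_of_norm_deriv_le
    (fun y _ => G.differentiableAt) hderiv
    (Set.right_mem_Icc.2 (by linarith)) (Set.left_mem_Icc.2 (by linarith))
  refine this.trans (le_of_eq ?_)
  rw [show x - (x + a) = -a by ring, norm_neg, Real.norm_of_nonneg ha]
  ring

section Cutoff

variable {ψ : ℝ → ℝ}

lemma hasCompactSupport_one_sub (hψ1 : ∀ θ : ℝ, 2 ≤ |θ| → ψ θ = 1) :
    HasCompactSupport (fun t : ℝ => 1 - (ψ t : ℂ)) := by
  refine HasCompactSupport.intro (isCompact_Icc (a := -2) (b := 2)) fun t ht => ?_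
  have : 2 ≤ |t| := by
    by_contra! h
    exact ht ⟨(abs_lt.1 h).1.le, (abs_lt.1 h).2.le⟩
  simp [hψ1 t this]

lemma zSeq_eq_fourier (hψ1 : ∀ θ : ℝ, 2 ≤ |θ| → ψ θ = 1) {ε : ℝ} (hε : 0 < ε) (hε1 : ε ≤ 1)
    (k : ℤ) :
    zSeq ψ ε k = ((ε / (2 * Real.pi) : ℝ) : ℂ) *
      𝓕 (fun t : ℝ => 1 - (ψ t : ℂ)) (-(ε / (2 * Real.pi)) * k) := by
  set g : ℝ → ℂ := fun t => Complex.exp (Complex.I * k * (ε * t : ℝ)) * (1 - (ψ t : ℂ))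
  have hg (θ : ℝ) : Complex.exp (Complex.I * k * θ) * (1 - (ψ (θ / ε) : ℂ)) = g (θ / ε) := by
    simp only [g]
    rw [mul_div_cancel₀ θ hε.ne']
  have hsupp : Function.support (fun θ => g (θ / ε)) ⊆ Set.Ioc (-Real.pi) Real.pi := by
    intro θ hθ
    have h2 : |θ / ε| < 2 := by
      by_contra! h
      exact hθ (by simp [g, hψ1 _ h])
    rw [abs_div, abs_of_pos hε, div_lt_iff₀ hε] at h2
    have h3 : |θ| < Real.pi := by linarith [Real.pi_gt_three]
    exact ⟨(abs_lt.1 h3).1, (abs_lt.1 h3).2.le⟩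
  have hfour : 𝓕 (fun t : ℝ => 1 - (ψ t : ℂ)) (-(ε / (2 * Real.pi)) * k) = ∫ t, g t := by
    rw [Real.fourier_real_eq_integral_exp_smul]
    congr 1 with t
    simp only [g, smul_eq_mul]
    congr 2
    push_cast
    have := Real.pi_ne_zero
    field_simp
  rw [zSeq, hfour]
  simp only [hg]
  rw [intervalIntegral.integral_eq_integral_of_support_subset hsupp,
    MeasureTheory.Measure.integral_comp_div, abs_of_pos hε, Complex.real_smul]
  push_cast
  ring

lemma exists_norm_zSeq_sub_le (hψ : ContDiff ℝ (⊤ : ℕ∞) ψ)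
    (hψ1 : ∀ θ : ℝ, 2 ≤ |θ| → ψ θ = 1) (N : ℕ) :
    ∃ C, 0 ≤ C ∧ ∀ ε : ℝ, 0 < ε → ε ≤ 1 → ∀ k : ℤ,
      ‖zSeq ψ ε k - zSeq ψ ε (k - 1)‖ ≤ C * ε ^ 2 * ((1 + ε * |(k : ℝ)|) ^ N)⁻¹ := by
  have hsmooth : ContDiff ℝ ∞ (fun t : ℝ => 1 - (ψ t : ℂ)) :=
    contDiff_const.sub (Complex.ofRealCLM.contDiff.comp hψ)
  set φ : 𝓢(ℝ, ℂ) := (hasCompactSupport_one_sub hψ1).toSchwartzMap hsmooth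
  obtain ⟨C, hC, hG⟩ := SchwartzMap.exists_norm_sub_le (𝓕 φ) N
  have hπ := Real.pi_gt_three
  refine ⟨(2 * Real.pi) ^ N * C, by positivity, fun ε hε hε1 k => ?_⟩
  set a := ε / (2 * Real.pi)
  have ha : 0 < a := by positivity
  have haε : a ≤ ε := div_le_self hε.le (by linarith)
  have hz (k : ℤ) : zSeq ψ ε k = (a : ℂ) * (𝓕 φ) (-a * k) := by
    rw [zSeq_eq_fourier hψ1 hε hε1, SchwartzMap.fourier_coe]
    rfl
  have hstep : -a * ((k - 1 : ℤ) : ℝ) = -a * k + a := by push_cast; ring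
  have hweight : ((1 + |-a * (k : ℝ)|) ^ N)⁻¹ ≤
      (2 * Real.pi) ^ N * ((1 + ε * |(k : ℝ)|) ^ N)⁻¹ := by
    have h : 1 + ε * |(k : ℝ)| ≤ 2 * Real.pi * (1 + |-a * (k : ℝ)|) := by
      have : 2 * Real.pi * |-a * (k : ℝ)| = ε * |(k : ℝ)| := by
        rw [abs_mul, abs_neg, abs_of_pos ha]
        simp only [a]
        field_simp
      rw [mul_add, this]
      linarith
    rw [← div_eq_mul_inv, inv_eq_one_div, div_le_div_iff₀ (by positivity) (by positivity),
      one_mul, ← mul_pow]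
    gcongr
  rw [hz, hz, ← mul_sub, norm_mul, Complex.norm_real, Real.norm_of_nonneg ha.le, hstep]
  calc a * ‖(𝓕 φ) (-a * k) - (𝓕 φ) (-a * k + a)‖
      ≤ ε * (C * ε * ((2 * Real.pi) ^ N * ((1 + ε * |(k : ℝ)|) ^ N)⁻¹)) := by
        refine mul_le_mul haε ((hG a ha.le (haε.trans hε1) _).trans ?_) (norm_nonneg _) hε.le
        gcongr
    _ = _ := by ring

lemma exists_abs_deltaIter_le (hψ : ContDiff ℝ (⊤ : ℕ∞) ψ)
    (hψ1 : ∀ θ : ℝ, 2 ≤ |θ| → ψ θ = 1) (p N : ℕ) :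
    ∃ C, 0 ≤ C ∧ ∀ ε : ℝ, 0 < ε → ε ≤ 1 → ∀ k : ℤ,
      |deltaIter ψ ε p k| ≤ C * (ε ^ 2 / ε ^ p) * ((1 + ε * |(k : ℝ)|) ^ N)⁻¹ := by
  induction p generalizing N with
  | zero => simpa [deltaIter] using exists_norm_zSeq_sub_le hψ hψ1 N
  | succ p ih =>
    obtain ⟨C, hC, h⟩ := ih (N + 2)
    refine ⟨4 * C, by positivity, fun ε hε hε1 k => ?_⟩
    have hA : 4 * (C * (ε ^ 2 / ε ^ p)) / ε = 4 * C * (ε ^ 2 / ε ^ (p + 1)) := by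
      rw [pow_succ ε p]
      field_simp
    rw [deltaIter, ← hA]
    split_ifs with hk
    · refine abs_tsum_subtype_le hε hε1 (by positivity) (h ε hε hε1) fun j hj => ?_
      exact_mod_cast (by grind : |k| ≤ |j|)
    · rw [abs_neg]
      refine abs_tsum_subtype_le hε hε1 (by positivity) (h ε hε hε1) fun j hj => ?_
      exact_mod_cast (by grind : |k| ≤ |j|)

end Cutoff

/-- `ℓ¹` bounds on the iterated differences: for each `j` there is `C_j > 0` with
`‖Δ_{ε,j}‖_{ℓ¹(ℤ)} ≤ C_j ε^{1-j}` for all `ε ∈ (0,1]`. -/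
theorem deltaIter_l1_bounds (ψ : ℝ → ℝ) (hψ : ContDiff ℝ (⊤ : ℕ∞) ψ)
    (hψ0 : ∀ θ : ℝ, |θ| ≤ 1 → ψ θ = 0)
    (hψ01 : ∀ θ : ℝ, 1 ≤ |θ| → |θ| ≤ 2 → ψ θ ∈ Set.Icc (0:ℝ) 1)
    (hψ1 : ∀ θ : ℝ, 2 ≤ |θ| → ψ θ = 1) :
    ∀ j : ℕ, ∃ C > (0:ℝ), ∀ ε ∈ Set.Ioc (0:ℝ) 1,
      Summable (fun k : ℤ => |deltaIter ψ ε j k|) ∧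
      ∑' k : ℤ, |deltaIter ψ ε j k| ≤ C * ε ^ ((1:ℝ) - (j:ℝ)) := by
  intro j
  obtain ⟨C, hC, h⟩ := exists_abs_deltaIter_le hψ hψ1 j 2
  refine ⟨4 * C + 1, by positivity, fun ε ⟨hε, hε1⟩ => ?_⟩
  obtain ⟨hs, ht⟩ := summable_and_tsum_inv_sq_le hε hε1
  have hs' := hs.mul_left (C * (ε ^ 2 / ε ^ j))
  have hsum := Summable.of_nonneg_of_le (fun k => abs_nonneg _) (h ε hε hε1) hs'
  have hpow : ε ^ ((1 : ℝ) - (j : ℝ)) = ε / ε ^ j := by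
    rw [Real.rpow_sub hε, Real.rpow_one, Real.rpow_natCast]
  refine ⟨hsum, (hsum.tsum_le_tsum (h ε hε hε1) hs').trans ?_⟩
  rw [tsum_mul_left, hpow]
  calc C * (ε ^ 2 / ε ^ j) * ∑' k : ℤ, ((1 + ε * |(k : ℝ)|) ^ 2)⁻¹
      ≤ C * (ε ^ 2 / ε ^ j) * (4 / ε) := by gcongr
    _ = 4 * C * (ε / ε ^ j) := by field_simp
    _ ≤ (4 * C + 1) * (ε / ε ^ j) := by gcongr; linarith
end

section
/- Let δ ∈ (0,1] and n ≥ 1 be an integer. Then for every λ ∈ ℂ of the form λ = r e^{iθ} with θ ∈ [−π,π] and 0 ≤ r ≤ max{0, 1 − δ|θ|}, one has |λⁿ(1 − λ)| ≤ (1 + δ⁻¹)/(e n). In particular, for every real t with 0 ≤ t ≤ 1/δ and every integer n ≥ 1, (1 + δ) t (1 − δt)ⁿ ≤ (1 + δ⁻¹)/(e n). -/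
open Filter Topology

theorem mul_one_sub_pow_le_inv_exp_mul {s : ℝ} (hs0 : 0 ≤ s) (hs1 : s ≤ 1) {n : ℕ}
    (hn : 1 ≤ n) : s * (1 - s) ^ n ≤ (Real.exp 1 * n)⁻¹ := by
  have hn0 : (0 : ℝ) < n := by exact_mod_cast hn
  have hpow : (1 - s) ^ n ≤ Real.exp (-(n * s)) := by
    calc (1 - s) ^ n ≤ Real.exp (-s) ^ n :=
          pow_le_pow_left₀ (by linarith) (Real.one_sub_le_exp_neg s) n
      _ = Real.exp (-(n * s)) := by rw [← Real.exp_nat_mul, mul_neg]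
  have hlin : n * s ≤ Real.exp (n * s - 1) := by
    linarith [Real.add_one_le_exp (n * s - 1)]
  rw [← one_div, le_div_iff₀ (by positivity)]
  calc s * (1 - s) ^ n * (Real.exp 1 * n) = (n * s) * (1 - s) ^ n * Real.exp 1 := by ring
    _ ≤ Real.exp (n * s - 1) * Real.exp (-(n * s)) * Real.exp 1 := by gcongr
    _ = 1 := by
        rw [← Real.exp_add, ← Real.exp_add, Real.exp_eq_one_iff]
        ring

/-- On the region below the curve `r = 1 - δ|θ|`, the distance to `1` is controlled by `1 - r`. -/
theorem norm_one_sub_mul_exp_le {δ r θ : ℝ} (hδ : 0 < δ) (hr : 0 ≤ r)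
    (hrθ : r ≤ 1 - δ * |θ|) :
    ‖1 - (r : ℂ) * Complex.exp (Complex.I * θ)‖ ≤ (1 + δ⁻¹) * (1 - r) := by
  have hθ : |θ| ≤ δ⁻¹ * (1 - r) := by
    rw [← div_eq_inv_mul, le_div_iff₀ hδ]
    linarith
  have hr1 : r ≤ 1 := by nlinarith [mul_nonneg hδ.le (abs_nonneg θ)]
  have hexp : ‖Complex.exp (Complex.I * θ) - 1‖ ≤ |θ| := by
    simpa using Real.norm_exp_I_mul_ofReal_sub_one_le (x := θ)
  calc ‖1 - (r : ℂ) * Complex.exp (Complex.I * θ)‖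
      = ‖((1 - r : ℝ) : ℂ) - (r : ℂ) * (Complex.exp (Complex.I * θ) - 1)‖ := by
        congr 1
        push_cast
        ring
    _ ≤ ‖((1 - r : ℝ) : ℂ)‖ + ‖(r : ℂ) * (Complex.exp (Complex.I * θ) - 1)‖ := norm_sub_le _ _
    _ = (1 - r) + r * ‖Complex.exp (Complex.I * θ) - 1‖ := by
        rw [norm_mul, Complex.norm_of_nonneg (sub_nonneg.2 hr1), Complex.norm_of_nonneg hr]
    _ ≤ (1 - r) + 1 * (δ⁻¹ * (1 - r)) := by
        gcongr
        exact hexp.trans hθ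
    _ = (1 + δ⁻¹) * (1 - r) := by ring

/-- Uniform bound on `|λⁿ(1-λ)|` over the region `Ω_δ` below the curve `r = 1 - δ|θ|`:
`sup_{λ∈Ω_δ} |λⁿ(1-λ)| ≤ (1+δ⁻¹)/(en)`, together with the scalar inequality
`(1+δ) t (1-δt)ⁿ ≤ (1+δ⁻¹)/(en)` for `0 ≤ t ≤ 1/δ`. -/
theorem omega_region_bound (δ : ℝ) (hδ : δ ∈ Set.Ioc (0:ℝ) 1) (n : ℕ) (hn : 1 ≤ n) :
    (∀ θ ∈ Set.Icc (-Real.pi) Real.pi, ∀ r : ℝ, 0 ≤ r → r ≤ max 0 (1 - δ * |θ|) →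
      ‖((r : ℂ) * Complex.exp (Complex.I * θ)) ^ n *
          (1 - (r : ℂ) * Complex.exp (Complex.I * θ))‖ ≤
        (1 + δ⁻¹) / (Real.exp 1 * n)) ∧
    (∀ t : ℝ, 0 ≤ t → t ≤ δ⁻¹ →
      (1 + δ) * t * (1 - δ * t) ^ n ≤ (1 + δ⁻¹) / (Real.exp 1 * n)) := by
  obtain ⟨hδ0, -⟩ := hδ
  have hc : 0 ≤ 1 + δ⁻¹ := by positivity
  refine ⟨fun θ _ r hr0 hr => ?_, fun t ht0 ht => ?_⟩
  · rcases hr0.eq_or_lt with rfl | hrpos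
    · rw [Complex.ofReal_zero, zero_mul, zero_pow (by omega), zero_mul, norm_zero]
      positivity
    have hrθ : r ≤ 1 - δ * |θ| := (le_max_iff.1 hr).resolve_left hrpos.not_ge
    have hr1 : r ≤ 1 := hrθ.trans (sub_le_self _ (by positivity))
    have hnorm : ‖(r : ℂ) * Complex.exp (Complex.I * θ)‖ = r := by
      rw [norm_mul, Complex.norm_exp_I_mul_ofReal, mul_one, Complex.norm_of_nonneg hr0]
    rw [norm_mul, norm_pow, hnorm]
    calc r ^ n * ‖1 - (r : ℂ) * Complex.exp (Complex.I * θ)‖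
        ≤ r ^ n * ((1 + δ⁻¹) * (1 - r)) := by
          gcongr
          exact norm_one_sub_mul_exp_le hδ0 hr0 hrθ
      _ = (1 + δ⁻¹) * ((1 - r) * (1 - (1 - r)) ^ n) := by
          rw [sub_sub_cancel]
          ring
      _ ≤ (1 + δ⁻¹) * (Real.exp 1 * n)⁻¹ :=
          mul_le_mul_of_nonneg_left
            (mul_one_sub_pow_le_inv_exp_mul (by linarith) (by linarith) hn) hc
      _ = (1 + δ⁻¹) / (Real.exp 1 * n) := (div_eq_mul_inv _ _).symm
  · have hδt : δ * t ≤ 1 := by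
      simpa [hδ0.ne'] using mul_le_mul_of_nonneg_left ht hδ0.le
    calc (1 + δ) * t * (1 - δ * t) ^ n = (1 + δ⁻¹) * ((δ * t) * (1 - δ * t) ^ n) := by
          field_simp
          ring
      _ ≤ (1 + δ⁻¹) * (Real.exp 1 * n)⁻¹ :=
          mul_le_mul_of_nonneg_left
            (mul_one_sub_pow_le_inv_exp_mul (by positivity) hδt hn) hc
      _ = (1 + δ⁻¹) / (Real.exp 1 * n) := (div_eq_mul_inv _ _).symm
end

section
/- Let X be a complex Hilbert space and let T be a power-bounded bounded linear operator on X such that σ(T) ∩ 𝕋 = {1}, and suppose there exist C > 0 and α ≥ 1 such that ‖R(e^{iθ},T)‖ ≤ C|θ|^{−α} for 0 < |θ| ≤ π. Then there exists C' > 0 such that ‖Tⁿ(I − T)‖ ≤ C' n^{−1/α} for all n ≥ 1. -/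
open Filter Topology

/-- Parseval's identity for vector-valued sums, for coefficients with orthogonal columns. -/
theorem sum_norm_sq_of_orthogonal {X : Type*} [NormedAddCommGroup X] [InnerProductSpace ℂ X]
    {s t : Finset ℕ} {c : ℕ → ℕ → ℂ} {M : ℝ}
    (h : ∀ j ∈ t, ∀ l ∈ t, ∑ i ∈ s, star (c i j) * c i l = if j = l then (M : ℂ) else 0)
    (g : ℕ → X) :
    ∑ i ∈ s, ‖∑ j ∈ t, c i j • g j‖ ^ 2 = M * ∑ j ∈ t, ‖g j‖ ^ 2 := by
  have key : ∑ i ∈ s, inner ℂ (∑ j ∈ t, c i j • g j) (∑ j ∈ t, c i j • g j)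
      = (M : ℂ) * ∑ j ∈ t, inner ℂ (g j) (g j) := by
    simp only [sum_inner, inner_sum, inner_smul_left, inner_smul_right, Finset.mul_sum]
    rw [Finset.sum_comm]
    refine Finset.sum_congr rfl fun j hj => ?_
    rw [Finset.sum_comm]
    have (l : ℕ) (hl : l ∈ t) :
        ∑ i ∈ s, c i j * ((starRingEnd ℂ) (c i l) * inner ℂ (g l) (g j))
          = if l = j then (M : ℂ) * inner ℂ (g j) (g j) else 0 := by
      calc _ = (∑ i ∈ s, star (c i l) * c i j) * inner ℂ (g l) (g j) := by
            rw [Finset.sum_mul]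
            exact Finset.sum_congr rfl fun i _ => by rw [starRingEnd_apply]; ring
        _ = _ := by
            rw [h l hl j hj]
            split_ifs with e
            · rw [e]
            · rw [zero_mul]
    rw [Finset.sum_congr rfl this, Finset.sum_ite_eq' t j, if_pos hj]
  simp only [inner_self_eq_norm_sq_to_K] at key
  apply Complex.ofReal_injective
  push_cast
  exact key

theorem sum_pow_eq_zero_of_pow_eq_one {q : ℂ} {N : ℕ} (hq : q ≠ 1) (hN : q ^ N = 1) :
    ∑ j ∈ Finset.range N, q ^ j = 0 := by
  rw [geom_sum_eq hq, hN, sub_self, zero_div]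

/-- The `N`-th roots of `-1` satisfy the discrete orthogonality relations; none of them is `1`. -/
theorem exists_orthogonal_roots_of_neg_one {N : ℕ} (hN : 0 < N) :
    ∃ l : ℕ → ℂ, (∀ j, ‖l j‖ = 1) ∧ (∀ j, l j ^ N = -1) ∧
      (∀ a b : ℕ, a < b + N → b < a + N →
        ∑ j ∈ Finset.range N, (l j)⁻¹ ^ a * l j ^ b = if a = b then (N : ℂ) else 0) ∧
      (∀ i ∈ Finset.range N, ∀ j ∈ Finset.range N,
        ∑ k ∈ Finset.range N, (l i)⁻¹ ^ k * l j ^ k = if i = j then (N : ℂ) else 0) := by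
  set w : ℂ := Complex.exp (2 * Real.pi * Complex.I / N) with hw
  set ζ : ℂ := Complex.exp (Real.pi * Complex.I / N) with hζ
  have hprim : IsPrimitiveRoot w N := Complex.isPrimitiveRoot_exp N hN.ne'
  have hN' : (N : ℂ) ≠ 0 := by exact_mod_cast hN.ne'
  have hζN : ζ ^ N = -1 := by
    rw [hζ, ← Complex.exp_nat_mul, mul_div_cancel₀ _ hN', Complex.exp_pi_mul_I]
  have hw0 : w ≠ 0 := Complex.exp_ne_zero _
  have hζ0 : ζ ≠ 0 := Complex.exp_ne_zero _
  have hl0 (j : ℕ) : ζ * w ^ j ≠ 0 := mul_ne_zero hζ0 (pow_ne_zero _ hw0)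
  have hroot (j : ℕ) : (ζ * w ^ j) ^ N = -1 := by
    rw [mul_pow, hζN, ← pow_mul, mul_comm j, pow_mul, hprim.pow_eq_one, one_pow, mul_one]
  have hone {m : ℤ} : (w ^ m) ^ N = 1 := by
    rw [← zpow_natCast, ← zpow_mul, mul_comm, zpow_mul, zpow_natCast, hprim.pow_eq_one, one_zpow]
  have hneq {m : ℤ} (h0 : m ≠ 0) (h1 : |m| < N) : w ^ m ≠ 1 := fun h =>
    h0 (Int.eq_zero_of_abs_lt_dvd ((hprim.zpow_eq_one_iff_dvd m).1 h) h1)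
  refine ⟨fun j => ζ * w ^ j, fun j => ?_, hroot, fun a b hab hba => ?_, fun i hi j hj => ?_⟩
  · refine (pow_eq_one_iff_of_nonneg (norm_nonneg _) hN.ne').1 ?_
    rw [← norm_pow, hroot, norm_neg, norm_one]
  · split_ifs with e
    · subst e
      simp only [← mul_pow, inv_mul_cancel₀ (hl0 _), one_pow, Finset.sum_const, Finset.card_range,
        nsmul_eq_mul, mul_one]
    · have (j : ℕ) : (ζ * w ^ j)⁻¹ ^ a * (ζ * w ^ j) ^ b
          = ζ ^ ((b : ℤ) - a) * (w ^ ((b : ℤ) - a)) ^ j := by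
        rw [← zpow_natCast (w ^ _) j, ← zpow_mul, mul_comm _ (j : ℤ), zpow_mul, ← mul_zpow,
          zpow_natCast, zpow_sub₀ (hl0 j), zpow_natCast, zpow_natCast, inv_pow, div_eq_inv_mul]
      simp only [this, ← Finset.mul_sum]
      rw [sum_pow_eq_zero_of_pow_eq_one (hneq (by lia) (by grind)) hone, mul_zero]
  · rw [Finset.mem_range] at hi hj
    split_ifs with e
    · subst e
      simp only [← mul_pow, inv_mul_cancel₀ (hl0 _), one_pow, Finset.sum_const, Finset.card_range,
        nsmul_eq_mul, mul_one]
    · have : (ζ * w ^ i)⁻¹ * (ζ * w ^ j) = w ^ ((j : ℤ) - i) := by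
        rw [zpow_sub₀ hw0, zpow_natCast, zpow_natCast]
        field_simp
      simp only [← mul_pow, this]
      exact sum_pow_eq_zero_of_pow_eq_one (hneq (by lia) (by grind)) hone

/-- For a power-bounded Hilbert space operator `T`, a bound for `S R(λ,T)` on the unit circle away
from `1` forces `‖T ^ (2n) S‖ = O(1/n)`. The proof applies Parseval's identity over the `2n`-th roots
of `-1`. -/
theorem norm_pow_mul_le_of_norm_mul_inverse_le {X : Type*} [NormedAddCommGroup X]
    [InnerProductSpace ℂ X] {T S : X →L[ℂ] X} (hTS : Commute T S) {K M : ℝ} (hK1 : 1 ≤ K)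
    (hK : ∀ n : ℕ, ‖T ^ n‖ ≤ K) (hM : 0 ≤ M)
    (hS : ∀ l : ℂ, ‖l‖ = 1 → l ≠ 1 → ∃ R : X →L[ℂ] X,
      (algebraMap ℂ (X →L[ℂ] X) l - T) * R = 1 ∧ ‖S * R‖ ≤ M)
    {n : ℕ} (hn : 0 < n) :
    ‖T ^ (2 * n) * S‖ ≤ K ^ 2 * (1 + K) * M / n := by
  obtain ⟨N, hN⟩ : ∃ N, N = 2 * n := ⟨_, rfl⟩
  obtain ⟨l, hl1, hlN, horth, horth'⟩ := exists_orthogonal_roots_of_neg_one (N := N) (by lia)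
  rw [← hN]
  have hl0 (j : ℕ) : l j ≠ 0 := fun h => by simpa [h] using hl1 j
  have hlne (j : ℕ) : l j ≠ 1 := fun h => by
    have := hlN j
    rw [h, one_pow] at this
    norm_num at this
  have hstar (j : ℕ) : star (l j) = (l j)⁻¹ := (Complex.inv_eq_conj (hl1 j)).symm
  refine ContinuousLinearMap.opNorm_le_bound _ (by positivity) fun x => ?_
  set P : ℕ → X →L[ℂ] X := fun j => ∑ a ∈ Finset.range N, ((l j)⁻¹) ^ a • T ^ a with hP
  set f : ℕ → X := fun j => ∑ i ∈ Finset.range n, ((l j)⁻¹) ^ i • (T ^ i) x with hf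
  have hSP (j : ℕ) : ‖S * P j‖ ≤ M * (1 + K) := by
    obtain ⟨R, hR, hSR⟩ := hS (l j) (hl1 j) (hlne j)
    have e1 : P j * (algebraMap ℂ _ (l j) - T) = l j • (1 + T ^ N) := by
      have e2 : algebraMap ℂ (X →L[ℂ] X) (l j) - T = l j • (1 - (l j)⁻¹ • T) := by
        rw [smul_sub, smul_smul, mul_inv_cancel₀ (hl0 j), one_smul, Algebra.algebraMap_eq_smul_one]
      have e3 : P j = ∑ a ∈ Finset.range N, ((l j)⁻¹ • T) ^ a := by
        simp only [hP, smul_pow]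
      rw [e2, mul_smul_comm, e3, geom_sum_mul_neg, smul_pow, inv_pow, hlN]
      norm_num
    have e4 : P j = l j • ((1 + T ^ N) * R) := by
      rw [← smul_mul_assoc, ← e1, mul_assoc, hR, mul_one]
    have hc : Commute S (1 + T ^ N) := (Commute.one_right S).add_right (hTS.symm.pow_right N)
    rw [e4, mul_smul_comm, norm_smul, hl1, one_mul, ← mul_assoc, hc.eq, mul_assoc, mul_comm M]
    refine (norm_mul_le _ _).trans ?_
    gcongr
    refine (norm_add_le _ _).trans ?_
    gcongr
    · exact ContinuousLinearMap.norm_id_le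
    · exact hK N
  set g : ℕ → X := fun j => (S * P j) (f j) with hg
  have hcoef (k : ℕ) (hk : n ≤ k) (hkN : k < N) :
      ∑ j ∈ Finset.range N, l j ^ k • g j = ((N * n : ℕ) : ℂ) • (T ^ k * S) x := by
    have e (j : ℕ) : l j ^ k • g j = ∑ i ∈ Finset.range n, ∑ a ∈ Finset.range N,
        ((l j)⁻¹ ^ (a + i) * l j ^ k) • (T ^ (a + i) * S) x := by
      simp only [hg, hf, hP, map_sum, map_smul, Finset.smul_sum]
      refine Finset.sum_congr rfl fun i _ => ?_
      rw [ContinuousLinearMap.mul_def, ContinuousLinearMap.comp_apply,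
        _root_.sum_apply, map_sum, Finset.smul_sum, Finset.smul_sum]
      refine Finset.sum_congr rfl fun a _ => ?_
      rw [_root_.smul_apply, map_smul, smul_smul, smul_smul,
        (hTS.pow_left (a + i)).eq, pow_add T]
      congr 1
      ring
    simp only [e]
    rw [Finset.sum_comm]
    have e' (i : ℕ) (hi : i ∈ Finset.range n) :
        ∑ j ∈ Finset.range N, ∑ a ∈ Finset.range N,
          ((l j)⁻¹ ^ (a + i) * l j ^ k) • (T ^ (a + i) * S) x = (N : ℂ) • (T ^ k * S) x := by
      rw [Finset.mem_range] at hi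
      rw [Finset.sum_comm]
      simp only [← Finset.sum_smul]
      rw [Finset.sum_eq_single (k - i)]
      · rw [horth _ _ (by lia) (by lia), if_pos (by lia), Nat.sub_add_cancel (by lia)]
      · intro a ha hne
        rw [Finset.mem_range] at ha
        rw [horth _ _ (by lia) (by lia), if_neg (by lia), zero_smul]
      · intro h
        rw [Finset.mem_range] at h
        lia
    rw [Finset.sum_congr rfl e', Finset.sum_const, Finset.card_range, ← Nat.cast_smul_eq_nsmul ℂ,
      smul_smul, Nat.cast_mul, mul_comm (N : ℂ)]
  have hsum : ∑ k ∈ Finset.Ico n N, ‖((N * n : ℕ) : ℂ) • (T ^ k * S) x‖ ^ 2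
      ≤ N * (N * (n * (M * (1 + K) * (K * ‖x‖)) ^ 2)) := by
    have hTx (i : ℕ) : ‖(T ^ i) x‖ ≤ K * ‖x‖ := (T ^ i).le_of_opNorm_le (hK i) x
    calc _ = ∑ k ∈ Finset.Ico n N, ‖∑ j ∈ Finset.range N, l j ^ k • g j‖ ^ 2 := by
          refine Finset.sum_congr rfl fun k hk => ?_
          rw [Finset.mem_Ico] at hk
          rw [hcoef k hk.1 hk.2]
      _ ≤ ∑ k ∈ Finset.range N, ‖∑ j ∈ Finset.range N, l j ^ k • g j‖ ^ 2 :=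
          Finset.sum_le_sum_of_subset_of_nonneg
            (fun k hk => Finset.mem_range.2 (Finset.mem_Ico.1 hk).2) fun _ _ _ => by positivity
      _ = N * ∑ j ∈ Finset.range N, ‖g j‖ ^ 2 := by
          refine sum_norm_sq_of_orthogonal (c := fun k j => l j ^ k) (fun i hi j hj => ?_) g
          simpa only [star_pow, hstar, Complex.ofReal_natCast] using horth' i hi j hj
      _ ≤ N * ∑ j ∈ Finset.range N, (M * (1 + K)) ^ 2 * ‖f j‖ ^ 2 := by
          gcongr with j
          rw [← mul_pow]
          gcongr
          exact (S * P j).le_of_opNorm_le (hSP j) (f j)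
      _ = N * ((M * (1 + K)) ^ 2 * (N * ∑ i ∈ Finset.range n, ‖(T ^ i) x‖ ^ 2)) := by
          rw [← Finset.mul_sum]
          congr 2
          refine sum_norm_sq_of_orthogonal (c := fun j i => (l j)⁻¹ ^ i) (fun i hi k hk => ?_) _
          rw [Finset.mem_range] at hi hk
          simp only [star_pow, star_inv₀, hstar, inv_inv, Complex.ofReal_natCast]
          rw [← if_congr (eq_comm (a := k) (b := i)) rfl rfl, ← horth k i (by lia) (by lia)]
          exact Finset.sum_congr rfl fun j _ => mul_comm _ _
      _ ≤ N * ((M * (1 + K)) ^ 2 * (N * ∑ i ∈ Finset.range n, (K * ‖x‖) ^ 2)) := by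
          gcongr with i
          exact hTx i
      _ = _ := by
          rw [Finset.sum_const, Finset.card_range, nsmul_eq_mul]
          ring
  have hlow (k : ℕ) (hk : k < N) : ‖(T ^ N * S) x‖ ≤ K * ‖(T ^ k * S) x‖ := by
    have : T ^ N * S = T ^ (N - k) * (T ^ k * S) := by
      rw [← mul_assoc, ← pow_add, Nat.sub_add_cancel hk.le]
    rw [this]
    exact (T ^ (N - k)).le_of_opNorm_le (hK _) _
  have hn0 : (0 : ℝ) < n := by exact_mod_cast hn
  have hN0 : (0 : ℝ) < N := by rw [hN]; push_cast; positivity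
  have hge : n * (N * n * ‖(T ^ N * S) x‖) ^ 2
      ≤ K ^ 2 * ∑ k ∈ Finset.Ico n N, ‖((N * n : ℕ) : ℂ) • (T ^ k * S) x‖ ^ 2 := by
    have hcard : (Finset.Ico n N).card = n := by rw [Nat.card_Ico]; lia
    rw [Finset.mul_sum]
    nth_rewrite 1 [← hcard]
    rw [← nsmul_eq_mul]
    refine Finset.card_nsmul_le_sum _ _ _ fun k hk => ?_
    rw [norm_smul, Complex.norm_natCast, ← mul_pow, Nat.cast_mul, mul_left_comm K]
    gcongr
    exact hlow k (Finset.mem_Ico.1 hk).2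
  have hsq : (n * ‖(T ^ N * S) x‖) ^ 2 ≤ (K * (M * (1 + K) * (K * ‖x‖))) ^ 2 := by
    have h := hge.trans (mul_le_mul_of_nonneg_left hsum (sq_nonneg K))
    refine le_of_mul_le_mul_left (a := (n * N ^ 2 : ℝ)) ?_ (by positivity)
    nlinarith
  have := (sq_le_sq₀ (by positivity) (by positivity)).1 hsq
  rw [div_mul_eq_mul_div, le_div_iff₀ hn0]
  linarith

/-- The resolvent of a power-bounded operator at `1 + δ` has norm at most `K / δ`. -/
theorem exists_inverse_one_add_sub {𝔸 : Type*} [NormedRing 𝔸] [NormedAlgebra ℂ 𝔸]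
    [CompleteSpace 𝔸] {T : 𝔸} {K : ℝ} (hK : ∀ n : ℕ, ‖T ^ n‖ ≤ K) {δ : ℝ} (hδ : 0 < δ) :
    ∃ V : 𝔸, V * (algebraMap ℂ 𝔸 (1 + δ) - T) = 1 ∧
      (algebraMap ℂ 𝔸 (1 + δ) - T) * V = 1 ∧ ‖V‖ ≤ K / δ := by
  set μ : ℂ := 1 + δ with hμ
  have hμ0 : μ = ((1 + δ : ℝ) : ℂ) := by simp [hμ]
  have hne : μ ≠ 0 := by rw [hμ0]; exact_mod_cast (by positivity : (1 + δ) ≠ 0)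
  have hnorm : ‖μ⁻¹‖ = (1 + δ)⁻¹ := by
    rw [norm_inv, hμ0, Complex.norm_real, Real.norm_of_nonneg (by positivity)]
  set t : 𝔸 := μ⁻¹ • T with ht
  have hb : ∀ k : ℕ, ‖t ^ k‖ ≤ K * (1 + δ)⁻¹ ^ k := fun k => by
    rw [ht, smul_pow, norm_smul, norm_pow, hnorm, mul_comm]
    gcongr; exact hK k
  have hg : HasSum (fun k : ℕ => K * (1 + δ)⁻¹ ^ k) (K * (1 - (1 + δ)⁻¹)⁻¹) :=
    (hasSum_geometric_of_lt_one (by positivity) (inv_lt_one_of_one_lt₀ (by linarith))).mul_left K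
  have hs : Summable fun k : ℕ => t ^ k := Summable.of_norm_bounded hg.summable hb
  have e : algebraMap ℂ 𝔸 μ - T = μ • (1 - t) := by
    rw [smul_sub, ht, smul_smul, mul_inv_cancel₀ hne, one_smul, Algebra.algebraMap_eq_smul_one]
  refine ⟨μ⁻¹ • ∑' k, t ^ k, ?_, ?_, ?_⟩
  · rw [e, smul_mul_smul_comm, inv_mul_cancel₀ hne, hs.tsum_pow_mul_one_sub, one_smul]
  · rw [e, smul_mul_smul_comm, mul_inv_cancel₀ hne, hs.one_sub_mul_tsum_pow, one_smul]
  · rw [norm_smul, hnorm]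
    calc _ ≤ (1 + δ)⁻¹ * (K * (1 - (1 + δ)⁻¹)⁻¹) := by
          gcongr; exact tsum_of_norm_bounded hg hb
      _ = K / δ := by
          have : 1 - (1 + δ)⁻¹ = δ / (1 + δ) := by field_simp; ring
          rw [this]; field_simp

theorem commute_of_inverse_algebraMap_sub {𝔸 : Type*} [Ring 𝔸] [Algebra ℂ 𝔸] {T V : 𝔸} {μ : ℂ}
    (hV : V * (algebraMap ℂ 𝔸 μ - T) = 1) (hV' : (algebraMap ℂ 𝔸 μ - T) * V = 1) :
    Commute T V := by
  have h : Commute (algebraMap ℂ 𝔸 μ - T) V := hV'.trans hV.symm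
  simpa using (Algebra.commute_algebraMap_left μ V).sub_left h

theorem one_sub_mul_inverse_eq {𝔸 : Type*} [Ring 𝔸] [Algebra ℂ 𝔸] {T R : 𝔸} {l : ℂ}
    (hR : (algebraMap ℂ 𝔸 l - T) * R = 1) : (1 - T) * R = 1 + (1 - l) • R := by
  nth_rewrite 2 [← hR]
  simp only [Algebra.algebraMap_eq_smul_one, sub_mul, smul_mul_assoc, one_mul, sub_smul, one_smul]
  abel

theorem norm_mul_pow_mul_inverse_le {𝔸 : Type*} [NormedRing 𝔸] [NormedAlgebra ℂ 𝔸] [NormOneClass 𝔸]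
    {T V R : 𝔸} {l μ : ℂ} {b : ℝ} (hV : V * (algebraMap ℂ 𝔸 μ - T) = 1)
    (hR : (algebraMap ℂ 𝔸 l - T) * R = 1)
    (hV' : (algebraMap ℂ 𝔸 μ - T) * V = 1) (hne : μ ≠ l)
    (hb : 1 ≤ b) (hB : ‖(1 - T) * V‖ ≤ b)
    (hz : ‖(1 - l) / (μ - l)‖ ≤ 2) (hw : ‖(μ - 1) / (μ - l)‖ ≤ 1) (m : ℕ) :
    ‖(1 - T) * ((1 - T) * V) ^ m * R‖
      ≤ ‖(1 - l) / (μ - l)‖ ^ m * ‖(1 - T) * R‖ + (3 * b) ^ m := by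
  set z := (1 - l) / (μ - l)
  set w := (μ - 1) / (μ - l)
  set A : 𝔸 := 1 - T with hA
  have hd : μ - l ≠ 0 := sub_ne_zero.2 hne
  have hcomm : Commute A V :=
    (Commute.one_left V).sub_left (commute_of_inverse_algebraMap_sub hV hV')
  have hVR : (μ - l) • (V * R) = R - V := by
    calc (μ - l) • (V * R)
        = V * (algebraMap ℂ 𝔸 μ - T) * R - V * ((algebraMap ℂ 𝔸 l - T) * R) := by
          simp only [Algebra.algebraMap_eq_smul_one, sub_mul, mul_sub, smul_mul_assoc,
            mul_smul_comm, mul_one, one_mul, sub_smul, mul_assoc]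
          abel
      _ = R - V := by rw [hV, hR, one_mul, mul_one]
  have hAR : A * R = 1 + (1 - l) • R := one_sub_mul_inverse_eq hR
  have hAV : A * V = 1 + (1 - μ) • V := one_sub_mul_inverse_eq hV'
  have hBR : A * V * R = z • R + w • V := by
    have : (μ - l) • (A * V * R) = (1 - l) • R + (μ - 1) • V := by
      rw [mul_assoc, ← mul_smul_comm, hVR, mul_sub, hAR, hAV]
      simp only [sub_smul]; abel
    calc A * V * R = (μ - l)⁻¹ • ((μ - l) • (A * V * R)) := by
          rw [smul_smul, inv_mul_cancel₀ hd, one_smul]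
      _ = _ := by
          rw [this, smul_add, smul_smul, smul_smul, ← div_eq_inv_mul, ← div_eq_inv_mul]
  have hpow : ∀ k : ℕ, ‖(A * V) ^ k‖ ≤ b ^ k := fun k =>
    (norm_pow_le _ _).trans (pow_le_pow_left₀ (norm_nonneg _) hB k)
  induction m with
  | zero => simp
  | succ m ih =>
    have hc : A * (A * V) ^ m = (A * V) ^ m * A := by
      have : Commute A (A * V) := (Commute.refl A).mul_right hcomm
      exact (this.pow_right m).eq
    have e : A * (A * V) ^ (m + 1) * R = z • (A * (A * V) ^ m * R) + w • (A * V) ^ (m + 1) := by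
      rw [pow_succ, ← mul_assoc, mul_assoc _ (A * V) R, hBR, mul_add, mul_smul_comm,
        mul_smul_comm, hc, mul_assoc _ A V]
    rw [e]
    calc _ ≤ ‖z‖ * ‖A * (A * V) ^ m * R‖ + ‖w‖ * ‖(A * V) ^ (m + 1)‖ := by
          rw [← norm_smul, ← norm_smul]; exact norm_add_le _ _
      _ ≤ ‖z‖ * (‖z‖ ^ m * ‖A * R‖ + (3 * b) ^ m) + 1 * b ^ (m + 1) := by
          gcongr; exact hpow _
      _ ≤ _ := by
          have h1 : ‖z‖ * (3 * b) ^ m ≤ 2 * b * (3 * b) ^ m := by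
            gcongr; linarith
          have h2 : b ^ m ≤ (3 * b) ^ m := by gcongr; linarith
          have h3 : b ^ m * b ≤ (3 * b) ^ m * b := by gcongr
          rw [pow_succ, pow_succ, pow_succ]
          nlinarith

/-- With `A = 1 - T` and `V = (δ + A)⁻¹`, the factor `(A V) ^ m` tames the resolvent near `1`. -/
theorem norm_mul_pow_mul_inverse_le_rpow {𝔸 : Type*} [NormedRing 𝔸] [NormedAlgebra ℂ 𝔸]
    [NormOneClass 𝔸] {T V R : 𝔸} {l : ℂ} {b C α δ t : ℝ} {m : ℕ} (hC : 0 ≤ C) (hα : 1 ≤ α)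
    (hm : α ≤ m) (hδ : 0 < δ) (hδ1 : δ ≤ 1) (ht : 0 < t)
    (hV : V * (algebraMap ℂ 𝔸 (1 + δ) - T) = 1) (hV' : (algebraMap ℂ 𝔸 (1 + δ) - T) * V = 1)
    (hR : (algebraMap ℂ 𝔸 l - T) * R = 1) (hb : 1 ≤ b) (hB : ‖(1 - T) * V‖ ≤ b)
    (hl : ‖l‖ = 1) (hlt : ‖1 - l‖ ≤ t) (hRn : ‖R‖ ≤ C * t ^ (-α)) :
    ‖(1 - T) * ((1 - T) * V) ^ m * R‖ ≤ (2 ^ m + 2 ^ m * C + (3 * b) ^ m) * δ ^ (1 - α) := by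
  have hδμ : δ ≤ ‖(1 + δ : ℂ) - l‖ := by
    have h1 : ‖(1 + δ : ℂ)‖ = 1 + δ := by
      rw [← Complex.ofReal_one, ← Complex.ofReal_add, Complex.norm_real,
        Real.norm_of_nonneg (by positivity)]
    have := norm_sub_norm_le (1 + δ : ℂ) l
    rw [h1, hl] at this
    linarith
  have hpos : 0 < ‖(1 + δ : ℂ) - l‖ := hδ.trans_le hδμ
  have hδn : ‖(δ : ℂ)‖ = δ := by rw [Complex.norm_real, Real.norm_of_nonneg hδ.le]
  have hz2 : ‖(1 - l) / (1 + δ - l)‖ ≤ 2 := by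
    rw [norm_div, div_le_iff₀ hpos]
    have h := norm_sub_le ((1 + δ : ℂ) - l) δ
    rw [show (1 + δ : ℂ) - l - δ = 1 - l by ring, hδn] at h
    linarith
  have hzt : ‖(1 - l) / (1 + δ - l)‖ ≤ t / δ := by
    rw [norm_div]
    gcongr
  have hw : ‖((1 + δ : ℂ) - 1) / (1 + δ - l)‖ ≤ 1 := by
    rw [norm_div, div_le_one hpos, add_sub_cancel_left, hδn]
    exact hδμ
  have hmain := norm_mul_pow_mul_inverse_le hV hR hV' (sub_ne_zero.1 (norm_pos_iff.1 hpos)) hb hB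
    hz2 hw m
  set ζ := ‖(1 - l) / (1 + δ - l)‖
  have hζ0 : 0 ≤ ζ := norm_nonneg _
  have hAR : ‖(1 - T) * R‖ ≤ 1 + C * t ^ (1 - α) := by
    calc ‖(1 - T) * R‖ ≤ 1 + ‖1 - l‖ * ‖R‖ := by
          rw [one_sub_mul_inverse_eq hR, ← norm_smul]
          exact (norm_add_le _ _).trans_eq (by rw [norm_one])
      _ ≤ 1 + t * (C * t ^ (-α)) := by gcongr
      _ = _ := by rw [sub_eq_add_neg, Real.rpow_add ht, Real.rpow_one]; ring
  have hδα : 1 ≤ δ ^ (1 - α) := Real.one_le_rpow_of_pos_of_le_one_of_nonpos hδ hδ1 (by linarith)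
  have hkey : ζ ^ m * t ^ (1 - α) ≤ 2 ^ m * δ ^ (1 - α) := by
    rcases le_total δ t with h | h
    · have : t ^ (1 - α) ≤ δ ^ (1 - α) := Real.rpow_le_rpow_of_nonpos hδ h (by linarith)
      gcongr
    · have hq : 0 < t / δ := by positivity
      have hq1 : t / δ ≤ 1 := (div_le_one hδ).2 h
      calc ζ ^ m * t ^ (1 - α) ≤ (t / δ) ^ m * t ^ (1 - α) := by gcongr
        _ = (t / δ) ^ (m + (1 - α)) * δ ^ (1 - α) := by
            rw [Real.rpow_add hq, Real.rpow_natCast, mul_assoc, ← Real.mul_rpow hq.le hδ.le,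
              div_mul_cancel₀ _ hδ.ne']
        _ ≤ 2 ^ m * δ ^ (1 - α) := by
            gcongr
            exact (Real.rpow_le_one hq.le hq1 (by linarith)).trans
              (one_le_pow₀ (by norm_num))
  calc _ ≤ ζ ^ m * (1 + C * t ^ (1 - α)) + (3 * b) ^ m := hmain.trans (by gcongr)
    _ = ζ ^ m * 1 + C * (ζ ^ m * t ^ (1 - α)) + (3 * b) ^ m * 1 := by ring
    _ ≤ 2 ^ m * δ ^ (1 - α) + C * (2 ^ m * δ ^ (1 - α)) + (3 * b) ^ m * δ ^ (1 - α) := by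
        gcongr
    _ = _ := by ring

theorem norm_pow_mul_one_sub_le {X : Type*} [NormedAddCommGroup X]
    [InnerProductSpace ℂ X] [CompleteSpace X] [Nontrivial X]
    {T : X →L[ℂ] X} {K : ℝ} (hK1 : 1 ≤ K) (hK : ∀ n : ℕ, ‖T ^ n‖ ≤ K)
    {C α : ℝ} (hC : 0 ≤ C) (hα : 1 ≤ α)
    (hR : ∀ l : ℂ, ‖l‖ = 1 → l ≠ 1 → ∃ R : X →L[ℂ] X, ∃ t : ℝ,
      (algebraMap ℂ (X →L[ℂ] X) l - T) * R = 1 ∧ 0 < t ∧ ‖1 - l‖ ≤ t ∧ ‖R‖ ≤ C * t ^ (-α))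
    {m : ℕ} (hm : α ≤ m) {p : ℕ} (hp : 2 ≤ p) :
    ‖T ^ p * (1 - T)‖ ≤ (K * ((1 + K) * ∑ i ∈ Finset.range m, (1 + K) ^ i) +
      4 * K ^ 3 * (1 + K) * (2 ^ m + 2 ^ m * C + (3 * (1 + K)) ^ m)) * (p : ℝ) ^ (-α⁻¹) := by
  set D := 2 ^ m + 2 ^ m * C + (3 * (1 + K)) ^ m with hD
  have hp0 : (0 : ℝ) < p := by exact_mod_cast (by lia : 0 < p)
  set δ := (p : ℝ) ^ (-α⁻¹) with hδ
  have hδ0 : 0 < δ := by positivity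
  have hδ1 : δ ≤ 1 := Real.rpow_le_one_of_one_le_of_nonpos (by exact_mod_cast (by lia : 1 ≤ p))
    (by simp only [Left.neg_nonpos_iff]; positivity)
  have hδp : δ ^ (1 - α) = δ * p := by
    rw [sub_eq_add_neg, Real.rpow_add hδ0, Real.rpow_one, hδ, ← Real.rpow_mul hp0.le,
      neg_mul_neg, inv_mul_cancel₀ (by positivity), Real.rpow_one]
  obtain ⟨V, hV, hV', hVn⟩ := exists_inverse_one_add_sub hK hδ0
  set A := 1 - T with hA
  have hAV : A * V = 1 - (δ : ℂ) • V := by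
    rw [hA, one_sub_mul_inverse_eq hV', sub_add_cancel_left, neg_smul, ← sub_eq_add_neg]
  have hB : ‖A * V‖ ≤ 1 + K := by
    rw [hAV]
    refine (norm_sub_le _ _).trans ?_
    rw [norm_one, norm_smul, Complex.norm_real, Real.norm_of_nonneg hδ0.le]
    gcongr
    rwa [← le_div_iff₀' hδ0]
  have hTA : Commute T A := (Commute.one_right T).sub_right (Commute.refl T)
  have hTV : Commute T V := commute_of_inverse_algebraMap_sub hV hV'
  have hTS : Commute T (A * (A * V) ^ m) := hTA.mul_right ((hTA.mul_right hTV).pow_right m)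
  have hrest : ‖A - A * (A * V) ^ m‖ ≤ δ * ((1 + K) * ∑ i ∈ Finset.range m, (1 + K) ^ i) := by
    have e : A - A * (A * V) ^ m = (δ : ℂ) • (A * V * ∑ i ∈ Finset.range m, (A * V) ^ i) := by
      have h1 : 1 - A * V = (δ : ℂ) • V := by rw [hAV]; abel
      calc _ = A * (1 - (A * V) ^ m) := by rw [mul_sub, mul_one]
        _ = _ := by
          rw [← mul_neg_geom_sum, h1, smul_mul_assoc, mul_smul_comm, mul_assoc]
    rw [e, norm_smul, Complex.norm_real, Real.norm_of_nonneg hδ0.le]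
    gcongr
    refine (norm_mul_le _ _).trans ?_
    gcongr
    refine norm_sum_le_of_le _ fun i _ => (norm_pow_le _ _).trans ?_
    gcongr
  have hn : 0 < p / 2 := by lia
  have hn0 : (0 : ℝ) < (p / 2 : ℕ) := by exact_mod_cast hn
  have hD0 : 0 ≤ D := by positivity
  have hS := norm_pow_mul_le_of_norm_mul_inverse_le hTS hK1 hK (M := D * δ ^ (1 - α))
    (by positivity) (fun l hl hl1 => by
      obtain ⟨R, t, hR, ht, hlt, hRn⟩ := hR l hl hl1
      exact ⟨R, hR, norm_mul_pow_mul_inverse_le_rpow hC hα hm hδ0 hδ1 ht hV hV' hR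
        (by linarith) hB hl hlt hRn⟩) hn
  have hpS : ‖T ^ p * (A * (A * V) ^ m)‖ ≤ 4 * K ^ 3 * (1 + K) * D * δ := by
    have e : T ^ p * (A * (A * V) ^ m)
        = T ^ (p % 2) * (T ^ (2 * (p / 2)) * (A * (A * V) ^ m)) := by
      rw [← mul_assoc (T ^ (p % 2)), ← pow_add, Nat.mod_add_div]
    have hpn : (p : ℝ) ≤ 4 * (p / 2 : ℕ) := by exact_mod_cast (by lia : p ≤ 4 * (p / 2))
    calc _ ≤ K * (K ^ 2 * (1 + K) * (D * δ ^ (1 - α)) / (p / 2 : ℕ)) := by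
          rw [e]
          refine (norm_mul_le _ _).trans ?_
          gcongr
          exact hK _
      _ = K ^ 3 * (1 + K) * D * δ * (p / (p / 2 : ℕ)) := by rw [hδp]; ring
      _ ≤ K ^ 3 * (1 + K) * D * δ * 4 := by
          gcongr
          rwa [div_le_iff₀ hn0]
      _ = _ := by ring
  calc ‖T ^ p * A‖ = ‖T ^ p * (A - A * (A * V) ^ m) + T ^ p * (A * (A * V) ^ m)‖ := by
        rw [← mul_add, sub_add_cancel]
    _ ≤ K * (δ * ((1 + K) * ∑ i ∈ Finset.range m, (1 + K) ^ i))
        + 4 * K ^ 3 * (1 + K) * D * δ := by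
        refine (norm_add_le _ _).trans (add_le_add ((norm_mul_le _ _).trans ?_) hpS)
        gcongr
        exact hK p
    _ = _ := by ring

/-- Sharp polynomial rate in the Katznelson–Tzafriri theorem on Hilbert spaces: if
`‖R(e^{iθ},T)‖ ≤ C|θ|^{-α}` then `‖Tⁿ(I-T)‖ ≤ C' n^{-1/α}`. -/
theorem kt_polynomial_rate_hilbert {X : Type*} [NormedAddCommGroup X]
    [InnerProductSpace ℂ X] [CompleteSpace X]
    (T : X →L[ℂ] X) (hpb : ∃ K : ℝ, ∀ n : ℕ, ‖T ^ n‖ ≤ K)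
    (hspec : spectrum ℂ T ∩ {z : ℂ | ‖z‖ = 1} = {1})
    (C α : ℝ) (hC : 0 < C) (hα : 1 ≤ α)
    (hres : ∀ θ : ℝ, 0 < |θ| → |θ| ≤ Real.pi →
      ‖resolvent T (Complex.exp (Complex.I * θ))‖ ≤ C * |θ| ^ (-α)) :
    ∃ C' > (0:ℝ), ∀ n : ℕ, 1 ≤ n →
      ‖T ^ n * (1 - T)‖ ≤ C' * (n : ℝ) ^ (-α⁻¹) := by
  rcases subsingleton_or_nontrivial X with hX | hX
  · refine ⟨1, one_pos, fun n _ => ?_⟩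
    rw [Subsingleton.elim (T ^ n * (1 - T)) 0, norm_zero]
    positivity
  obtain ⟨K₀, hK₀⟩ := hpb
  obtain ⟨K, hK1, hK⟩ : ∃ K : ℝ, 1 ≤ K ∧ ∀ n : ℕ, ‖T ^ n‖ ≤ K :=
    ⟨max K₀ 1, le_max_right _ _, fun n => (hK₀ n).trans (le_max_left _ _)⟩
  have hR (l : ℂ) (hl : ‖l‖ = 1) (hl1 : l ≠ 1) : ∃ R : X →L[ℂ] X, ∃ t : ℝ,
      (algebraMap ℂ (X →L[ℂ] X) l - T) * R = 1 ∧ 0 < t ∧ ‖1 - l‖ ≤ t ∧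
        ‖R‖ ≤ C * t ^ (-α) := by
    have hexp : Complex.exp (Complex.I * l.arg) = l := by
      simpa [hl, mul_comm] using Complex.norm_mul_exp_arg_mul_I l
    have harg : 0 < |l.arg| := abs_pos.2 fun h => hl1 (by rw [← hexp, h]; simp)
    have hu : IsUnit (algebraMap ℂ (X →L[ℂ] X) l - T) := by
      by_contra h
      have : l ∈ spectrum ℂ T ∩ {z : ℂ | ‖z‖ = 1} := ⟨h, hl⟩
      rw [hspec] at this
      exact hl1 this
    refine ⟨resolvent T l, |l.arg|, Ring.mul_inverse_cancel _ hu, harg, ?_, ?_⟩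
    · have := Real.norm_exp_I_mul_ofReal_sub_one_le (x := l.arg)
      rwa [hexp, norm_sub_rev] at this
    · have := hres l.arg harg (Complex.abs_arg_le_pi l)
      rwa [hexp] at this
  have hpos : 0 < K * ((1 + K) * ∑ i ∈ Finset.range ⌈α⌉₊, (1 + K) ^ i) +
      4 * K ^ 3 * (1 + K) * (2 ^ ⌈α⌉₊ + 2 ^ ⌈α⌉₊ * C + (3 * (1 + K)) ^ ⌈α⌉₊) := by positivity
  refine ⟨_, add_pos_of_nonneg_of_pos (norm_nonneg (T * (1 - T))) hpos, fun n hn => ?_⟩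
  rcases hn.eq_or_lt with rfl | hn
  · rw [pow_one, Nat.cast_one, Real.one_rpow, mul_one]
    exact le_add_of_nonneg_right hpos.le
  · refine (norm_pow_mul_one_sub_le hK1 hK hC.le hα hR (Nat.le_ceil α) hn).trans ?_
    exact mul_le_mul_of_nonneg_right (le_add_of_nonneg_left (norm_nonneg _)) (by positivity)
end
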